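/- arXiv:2510.13071 — 5 statements merged into one kernel-verified Lean document; each statement's English description precedes it below -/
import Mathlib

section
/- Let N = (N_i)_{i≥0} be a sequence of nonnegative real matrices in (2×2) upper triangular block form N = [[A,C],[0,B]], where A is column-reduced and B is either column-reduced or identically zero. Then the map I(u, w) = ι(u) + ι(w) is a well-defined bijection from V_A^0 × V_{B dist}^0 onto V_N^0 (for u ∈ V_A^0 the limit ι(u) automatically exists and equals the zero-extension of u). -/
open Filter Topology Matrix

noncomputable section

/-- The product `N_k N_{k+1} ⋯ N_{k+m}` of a nonstationary sequence of matrices,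
i.e. the matrix written `N_k^n` (with `n = k + m`) in the paper. -/
def matProd {A : ℕ → Type} [∀ i, Fintype (A i)]
    (N : ∀ i, Matrix (A i) (A (i + 1)) ℝ) (k : ℕ) :
    ∀ m : ℕ, Matrix (A k) (A (k + m + 1)) ℝ
  | 0 => N k
  | m + 1 => matProd N k m * N (k + m + 1)

/-- `V_N^0`: nonnegative fixed-point sequences (`w_i ∈ C_i`, `w_i = N_i w_{i+1}`). -/
def V0 {A : ℕ → Type} [∀ i, Fintype (A i)] (N : ∀ i, Matrix (A i) (A (i + 1)) ℝ) :
    Set (∀ i, A i → ℝ) :=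
  {w | (∀ i a, 0 ≤ w i a) ∧ ∀ i, w i = (N i).mulVec (w (i + 1))}

/-- `V_N`: nonnegative eigenvector sequences of eigenvalue one (never zero). -/
def Vpos {A : ℕ → Type} [∀ i, Fintype (A i)] (N : ∀ i, Matrix (A i) (A (i + 1)) ℝ) :
    Set (∀ i, A i → ℝ) := {w | w ∈ V0 N ∧ ∀ i, w i ≠ 0}

/-- `V_N^Δ`: members of `V_N` whose initial vector lies in the unit simplex `Δ₀`
(for the `L¹` norm `‖u‖ = ∑ₐ |u a|`). -/
def VDelta {A : ℕ → Type} [∀ i, Fintype (A i)] (N : ∀ i, Matrix (A i) (A (i + 1)) ℝ) :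
    Set (∀ i, A i → ℝ) := {w | w ∈ Vpos N ∧ ∑ a, |w 0 a| = 1}

/-- The sequence `N` is primitive: for every `k` there is `n > k` (here `n = k + m`, `m ≥ 1`)
such that every entry of `N_k^n` is strictly positive. -/
def Primitive {A : ℕ → Type} [∀ i, Fintype (A i)] (N : ∀ i, Matrix (A i) (A (i + 1)) ℝ) : Prop :=
  ∀ k, ∃ m, 0 < m ∧ ∀ (a : A k) (b : A (k + m + 1)), 0 < matProd N k m a b

/-- The diagonal `A`-block of a `(2×2)` block sequence on alphabets `α_i ⊕ β_i`. -/
def Ablk {α β : ℕ → Type} (N : ∀ i, Matrix (α i ⊕ β i) (α (i + 1) ⊕ β (i + 1)) ℝ) :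
    ∀ i, Matrix (α i) (α (i + 1)) ℝ :=
  fun i => Matrix.of fun a b => N i (Sum.inl a) (Sum.inl b)

/-- The diagonal `B`-block of a `(2×2)` block sequence on alphabets `α_i ⊕ β_i`. -/
def Bblk {α β : ℕ → Type} (N : ∀ i, Matrix (α i ⊕ β i) (α (i + 1) ⊕ β (i + 1)) ℝ) :
    ∀ i, Matrix (β i) (β (i + 1)) ℝ :=
  fun i => Matrix.of fun a b => N i (Sum.inr a) (Sum.inr b)

/-- Iterating `N` on a sequence of vectors: `N_k ⋯ N_{k+m} x_{k+m+1}`. -/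
def iterVec {A : ℕ → Type} [∀ i, Fintype (A i)] (N : ∀ i, Matrix (A i) (A (i + 1)) ℝ)
    (k m : ℕ) (x : ∀ i, A i → ℝ) : A k → ℝ :=
  (matProd N k m).mulVec (x (k + m + 1))

section iterVec

variable {A : ℕ → Type} [∀ i, Fintype (A i)] {N : ∀ i, Matrix (A i) (A (i + 1)) ℝ}

theorem iterVec_succ (k m : ℕ) (x : ∀ i, A i → ℝ) :
    iterVec N k (m + 1) x = iterVec N k m (fun j => (N j).mulVec (x (j + 1))) :=
  (Matrix.mulVec_mulVec _ _ _).symm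

theorem iterVec_succ_left (k m : ℕ) (x : ∀ i, A i → ℝ) :
    iterVec N k (m + 1) x = (N k).mulVec (iterVec N (k + 1) m x) := by
  induction m generalizing x with
  | zero => exact (Matrix.mulVec_mulVec _ _ _).symm
  | succ m ih => rw [iterVec_succ, ih, iterVec_succ (k + 1)]

theorem iterVec_add (k m : ℕ) (x y : ∀ i, A i → ℝ) :
    iterVec N k m (x + y) = iterVec N k m x + iterVec N k m y :=
  Matrix.mulVec_add _ _ _

theorem iterVec_of_fixed {x : ∀ i, A i → ℝ} (hx : ∀ i, x i = (N i).mulVec (x (i + 1)))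
    (k m : ℕ) : iterVec N k m x = x k := by
  induction m with
  | zero => exact (hx k).symm
  | succ m ih => rw [iterVec_succ, ← funext hx, ih]

theorem matProd_nonneg (hN : ∀ i a b, 0 ≤ N i a b) (k m : ℕ) (a : A k) (b : A (k + m + 1)) :
    0 ≤ matProd N k m a b := by
  induction m with
  | zero => exact hN k a b
  | succ m ih => exact Finset.sum_nonneg fun c _ => mul_nonneg (ih c) (hN _ c b)

theorem iterVec_mono (hN : ∀ i a b, 0 ≤ N i a b) (k m : ℕ) {x y : ∀ i, A i → ℝ}
    (h : x ≤ y) : iterVec N k m x ≤ iterVec N k m y := fun a =>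
  Finset.sum_le_sum fun b _ =>
    mul_le_mul_of_nonneg_left (h _ b) (matProd_nonneg hN k m a b)

theorem iterVec_monotone (hN : ∀ i a b, 0 ≤ N i a b) (k : ℕ) {x : ∀ i, A i → ℝ}
    (hx : ∀ i, x i ≤ (N i).mulVec (x (i + 1))) : Monotone fun m => iterVec N k m x :=
  monotone_nat_of_le_succ fun m => by
    rw [iterVec_succ]
    exact iterVec_mono hN k m hx

/-- Limits of the iteration form a fixed-point sequence. -/
theorem fixed_of_tendsto_iterVec {x L : ∀ i, A i → ℝ}
    (h : ∀ i, Tendsto (fun m => iterVec N i m x) atTop (𝓝 (L i))) (i : ℕ) :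
    L i = (N i).mulVec (L (i + 1)) := by
  refine tendsto_nhds_unique ((tendsto_add_atTop_iff_nat 1).2 (h i)) ?_
  simp only [iterVec_succ_left]
  exact ((Continuous.matrix_mulVec continuous_const continuous_id).tendsto _).comp (h (i + 1))

end iterVec

section Block

variable {α β : ℕ → Type} [∀ i, Fintype (α i)] [∀ i, Fintype (β i)]
  {N : ∀ i, Matrix (α i ⊕ β i) (α (i + 1) ⊕ β (i + 1)) ℝ}

theorem mulVec_inr (htri : ∀ i (b : β i) (a : α (i + 1)), N i (Sum.inr b) (Sum.inl a) = 0)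
    (i : ℕ) (x : α (i + 1) ⊕ β (i + 1) → ℝ) (b : β i) :
    (N i).mulVec x (Sum.inr b) = (Bblk N i).mulVec (x ∘ Sum.inr) b := by
  simp [Matrix.mulVec, dotProduct, Fintype.sum_sum_type, htri, Bblk]

theorem mulVec_inl_of_inr_eq_zero (i : ℕ) {x : α (i + 1) ⊕ β (i + 1) → ℝ}
    (hx : ∀ b, x (Sum.inr b) = 0) (a : α i) :
    (N i).mulVec x (Sum.inl a) = (Ablk N i).mulVec (x ∘ Sum.inl) a := by
  simp [Matrix.mulVec, dotProduct, Fintype.sum_sum_type, hx, Ablk]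

theorem zeroExtend_fixed (htri : ∀ i (b : β i) (a : α (i + 1)), N i (Sum.inr b) (Sum.inl a) = 0)
    {u : ∀ i, α i → ℝ} (hu : ∀ i, u i = (Ablk N i).mulVec (u (i + 1))) (i : ℕ) :
    (Sum.elim (u i) (0 : β i → ℝ)) =
      (N i).mulVec (Sum.elim (u (i + 1)) (0 : β (i + 1) → ℝ)) := by
  ext (a | b)
  · rw [mulVec_inl_of_inr_eq_zero i (fun _ => rfl), Sum.elim_comp_inl, ← hu]
    rfl
  · rw [mulVec_inr htri, Sum.elim_comp_inr, Matrix.mulVec_zero]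
    rfl

theorem iterVec_inr (htri : ∀ i (b : β i) (a : α (i + 1)), N i (Sum.inr b) (Sum.inl a) = 0)
    {w : ∀ i, β i → ℝ} (hw : ∀ i, w i = (Bblk N i).mulVec (w (i + 1))) (k m : ℕ) (b : β k) :
    iterVec (A := fun j => α j ⊕ β j) N k m (fun j => Sum.elim 0 (w j)) (Sum.inr b) = w k b := by
  induction m generalizing k with
  | zero =>
    refine (mulVec_inr htri k _ b).trans ?_
    rw [Sum.elim_comp_inr]
    exact (congrFun (hw k) b).symm
  | succ m ih =>
    rw [iterVec_succ_left, mulVec_inr htri, hw k]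
    congr 1
    exact funext fun c => ih (k + 1) c

theorem zeroExtend_le_mulVec (hN0 : ∀ i x y, 0 ≤ N i x y)
    (htri : ∀ i (b : β i) (a : α (i + 1)), N i (Sum.inr b) (Sum.inl a) = 0)
    {w : ∀ i, β i → ℝ} (hw : w ∈ V0 (Bblk N)) (i : ℕ) :
    Sum.elim (0 : α i → ℝ) (w i) ≤
      (N i).mulVec (Sum.elim (0 : α (i + 1) → ℝ) (w (i + 1))) := by
  rintro (a | b)
  · refine Finset.sum_nonneg fun c _ => mul_nonneg (hN0 _ _ _) ?_
    rcases c with c | c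
    · exact le_rfl
    · exact hw.1 _ c
  · rw [mulVec_inr htri, Sum.elim_comp_inr, ← hw.2 i]
    rfl

theorem inr_mem_V0 (htri : ∀ i (b : β i) (a : α (i + 1)), N i (Sum.inr b) (Sum.inl a) = 0)
    {v : ∀ i, α i ⊕ β i → ℝ} (hv : v ∈ V0 (A := fun j => α j ⊕ β j) N) :
    (fun i => v i ∘ Sum.inr) ∈ V0 (Bblk N) := by
  refine ⟨fun i b => hv.1 i _, fun i => funext fun b => ?_⟩
  rw [← mulVec_inr htri]
  exact congrFun (hv.2 i) (Sum.inr b)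

/-- The limit of the iteration started at the `β`-part of a member of `V_N^0` exists. -/
theorem exists_tendsto_iterVec_inr (hN0 : ∀ i x y, 0 ≤ N i x y)
    (htri : ∀ i (b : β i) (a : α (i + 1)), N i (Sum.inr b) (Sum.inl a) = 0)
    {v : ∀ i, α i ⊕ β i → ℝ} (hv : v ∈ V0 (A := fun j => α j ⊕ β j) N) (i : ℕ) :
    ∃ l : α i ⊕ β i → ℝ, l ≤ v i ∧ Tendsto (fun m => iterVec (A := fun j => α j ⊕ β j) N i m
      (fun j => Sum.elim 0 (v j ∘ Sum.inr))) atTop (𝓝 l) := by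
  have hle : ∀ m, iterVec (A := fun j => α j ⊕ β j) N i m
      (fun j => Sum.elim 0 (v j ∘ Sum.inr)) ≤ v i := fun m => by
    refine (iterVec_mono (A := fun j => α j ⊕ β j) hN0 i m (y := v) fun j => ?_).trans_eq
      (iterVec_of_fixed hv.2 i m)
    rintro (a | b)
    · exact hv.1 j _
    · exact le_rfl
  have hmono := iterVec_monotone (A := fun j => α j ⊕ β j) hN0 i
    (zeroExtend_le_mulVec hN0 htri (inr_mem_V0 htri hv))
  have hlim := tendsto_atTop_ciSup hmono ⟨v i, Set.forall_mem_range.2 hle⟩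
  exact ⟨_, le_of_tendsto' hlim hle, hlim⟩

end Block

/-- for a sequence `N = [[A, C],[0, B]]` of nonnegative real matrices in `(2×2)`
upper triangular block form, with `A` column-reduced and `B` either column-reduced or
identically zero, the map `I(u,w) = ι(u) + ι(w)` is a well-defined bijection from
`V_A^0 × V_{B dist}^0` onto `V_N^0`; moreover for `u ∈ V_A^0` the limit `ι(u)` automatically
exists and equals the zero-extension of `u`.  (Here `ι` is the limit of the iteration by `N`
of the zero-extension, and `I` is characterized by the tendsto condition, since
`N_i^n (e(u_{n+1}) + e(w_{n+1})) → ι(u)_i + ι(w)_i`.) -/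
theorem statement1 (α β : ℕ → Type) [∀ i, Fintype (α i)] [∀ i, Fintype (β i)]
    [∀ i, Nonempty (α i)] [∀ i, Nonempty (β i)]
    (N : ∀ i, Matrix (α i ⊕ β i) (α (i + 1) ⊕ β (i + 1)) ℝ)
    (hN0 : ∀ i x y, 0 ≤ N i x y)
    (htri : ∀ i (b : β i) (a : α (i + 1)), N i (Sum.inr b) (Sum.inl a) = 0)
    (hAcol : ∀ i (b : α (i + 1)), ∃ a : α i, Ablk N i a b ≠ 0)
    (hB : (∀ i (b : β (i + 1)), ∃ a : β i, Bblk N i a b ≠ 0) ∨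
          (∀ i (a : β i) (b : β (i + 1)), Bblk N i a b = 0)) :
    (∀ u ∈ V0 (Ablk N), ∀ i,
      Tendsto (fun m => (matProd (A := fun j => α j ⊕ β j) N i m).mulVec
          (Sum.elim (u (i + m + 1)) (0 : β (i + m + 1) → ℝ)))
        atTop (𝓝 (Sum.elim (u i) (0 : β i → ℝ)))) ∧
    ∃ I : {u : ∀ i, α i → ℝ // u ∈ V0 (Ablk N)} ×
          {w : ∀ i, β i → ℝ // w ∈ V0 (Bblk N) ∧ ∀ i, ∃ v : (α i ⊕ β i) → ℝ,
            Tendsto (fun m => (matProd (A := fun j => α j ⊕ β j) N i m).mulVec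
              (Sum.elim (0 : α (i + m + 1) → ℝ) (w (i + m + 1)))) atTop (𝓝 v)} →
          {v : ∀ i, (α i ⊕ β i) → ℝ // v ∈ V0 N},
      Function.Bijective I ∧
      ∀ p, ∀ i, Tendsto (fun m => (matProd (A := fun j => α j ⊕ β j) N i m).mulVec
          (Sum.elim (p.1.1 (i + m + 1)) (p.2.1 (i + m + 1)))) atTop (𝓝 ((I p).1 i)) := by
  have hA : ∀ u ∈ V0 (Ablk N), ∀ i, Tendsto (fun m => iterVec (A := fun j => α j ⊕ β j) N i m
      (fun j => Sum.elim (u j) (0 : β j → ℝ))) atTop (𝓝 (Sum.elim (u i) (0 : β i → ℝ))) :=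
    fun u hu i => by
      simp only [iterVec_of_fixed (A := fun j => α j ⊕ β j) (zeroExtend_fixed htri hu.2)]
      exact tendsto_const_nhds
  refine ⟨hA, ?_⟩
  choose L hL' using fun (w : {w : ∀ i, β i → ℝ // w ∈ V0 (Bblk N) ∧ ∀ i, ∃ v : (α i ⊕ β i) → ℝ,
    Tendsto (fun m => (matProd (A := fun j => α j ⊕ β j) N i m).mulVec
      (Sum.elim (0 : α (i + m + 1) → ℝ) (w (i + m + 1)))) atTop (𝓝 v)}) => w.2.2
  have hL : ∀ w i, Tendsto (fun m => iterVec (A := fun j => α j ⊕ β j) N i m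
      (fun j => Sum.elim (0 : α j → ℝ) (w.1 j))) atTop (𝓝 (L w i)) := hL'
  have hLfix : ∀ w i, L w i = (N i).mulVec (L w (i + 1)) := fun w =>
    fixed_of_tendsto_iterVec (A := fun j => α j ⊕ β j) (hL w)
  have hLinr : ∀ w i b, L w i (Sum.inr b) = w.1 i b := fun w i b => by
    have h := tendsto_pi_nhds.1 (hL w i) (Sum.inr b)
    simp only [iterVec_inr htri w.2.1.2] at h
    exact tendsto_nhds_unique h tendsto_const_nhds
  have hLnonneg : ∀ w i, 0 ≤ L w i := fun w i => ge_of_tendsto' (hL w i) fun m x =>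
    Finset.sum_nonneg fun c _ => mul_nonneg
      (matProd_nonneg (A := fun j => α j ⊕ β j) hN0 i m x c) <| by
        rcases c with c | c
        · exact le_rfl
        · exact w.2.1.1 _ c
  refine ⟨fun p => ⟨fun i => Sum.elim (p.1.1 i) 0 + L p.2 i, fun i x => ?_, fun i => ?_⟩,
    ⟨?_, ?_⟩, fun p i => ?_⟩
  · refine add_nonneg ?_ (hLnonneg p.2 i x)
    rcases x with a | b
    · exact p.1.2.1 i a
    · exact le_rfl
  · rw [Matrix.mulVec_add, ← hLfix, ← zeroExtend_fixed htri p.1.2.2]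
  · rintro ⟨u, w⟩ ⟨u', w'⟩ h
    have h' : ∀ i (x : α i ⊕ β i), (Sum.elim (u.1 i) (0 : β i → ℝ) + L w i) x =
        (Sum.elim (u'.1 i) (0 : β i → ℝ) + L w' i) x :=
      fun i x => congrFun (congrFun (congrArg Subtype.val h) i) x
    obtain rfl : w = w' := Subtype.ext <| funext fun i => funext fun b => by
      simpa [hLinr] using h' i (Sum.inr b)
    obtain rfl : u = u' := Subtype.ext <| funext fun i => funext fun a => by
      simpa using h' i (Sum.inl a)
    rfl
  · rintro ⟨v, hv⟩
    have hlim := exists_tendsto_iterVec_inr hN0 htri hv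
    let w : {w : ∀ i, β i → ℝ // w ∈ V0 (Bblk N) ∧
        ∀ i, ∃ v : (α i ⊕ β i) → ℝ,
          Tendsto (fun m => (matProd (A := fun j => α j ⊕ β j) N i m).mulVec
            (Sum.elim (0 : α (i + m + 1) → ℝ) (w (i + m + 1)))) atTop (𝓝 v)} :=
      ⟨fun i => v i ∘ Sum.inr, inr_mem_V0 htri hv, fun i => (hlim i).imp fun _ h => h.2⟩
    have hle : ∀ i, L w i ≤ v i := fun i => by
      obtain ⟨l, hl, hl'⟩ := hlim i
      rwa [tendsto_nhds_unique (hL w i) hl']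
    have hinr : ∀ i b, (v i - L w i) (Sum.inr b) = 0 := fun i b =>
      sub_eq_zero.2 (hLinr w i b).symm
    refine ⟨⟨⟨fun i => (v i - L w i) ∘ Sum.inl, fun i a => sub_nonneg.2 (hle i _),
      fun i => funext fun a => ?_⟩, w⟩, Subtype.ext <| funext fun i => funext fun x => ?_⟩
    · rw [← mulVec_inl_of_inr_eq_zero i (hinr (i + 1)), Matrix.mulVec_sub, ← hLfix, ← hv.2 i]
      rfl
    · rcases x with a | b
      · exact sub_add_cancel _ _
      · exact (zero_add _).trans (hLinr w i b)
  · refine ((hA p.1.1 p.1.2 i).add (hL p.2 i)).congr fun m => ?_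
    rw [← iterVec_add]
    refine congrArg (matProd (A := fun j => α j ⊕ β j) N i m).mulVec (funext fun x => ?_)
    rcases x with a | b
    · exact add_zero _
    · exact zero_add _
end
end

section
/- Let N = (N_i)_{i≥0} be a column-reduced sequence of nonnegative real matrices whose alphabets are partitioned as A_i = ⊔_{k=1}^{L} A_i^k, such that N is upper triangular with respect to this partition ((N_i)_{ab} = 0 whenever a ∈ A_i^k and b ∈ A_{i+1}^j with j < k), and such that each diagonal block sequence A_k = ((N_i)|_{A_i^k × A_{i+1}^k})_{i≥0} is either column-reduced and primitive or identically zero. Then the map I(w_1, …, w_L) = ι(w_1) + ⋯ + ι(w_L) is a bijection from ∏_{k=1}^{L} V_{A_k dist}^0 onto V_N^0. -/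
open Filter Topology Matrix

noncomputable section

/-- The `k`-th diagonal block of a sequence of matrices on the partitioned alphabets
`A_i = ⊔_k P i k` (modelled as sigma types). -/
def diagBlk {L : ℕ} {P : ℕ → Fin L → Type}
    (N : ∀ i, Matrix ((k : Fin L) × P i k) ((k : Fin L) × P (i + 1) k) ℝ) (k : Fin L) :
    ∀ i, Matrix (P i k) (P (i + 1) k) ℝ :=
  fun i => Matrix.of fun a b => N i ⟨k, a⟩ ⟨k, b⟩

/-- The zero-extension `e_k` of a vector indexed by the `k`-th part to the full alphabet. -/
def extk {L : ℕ} {P : ℕ → Fin L → Type} (k : Fin L) (j : ℕ) (u : P j k → ℝ) :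
    ((k' : Fin L) × P j k') → ℝ :=
  fun x => if h : x.1 = k then u (cast (congrArg (P j) h) x.2) else 0

/-- The operator `(w_i) ↦ (N_i w_{i+1})` on sequences of vectors; its nonnegative fixed points
are the elements of `V0 N`. -/
def mulVecShift {A : ℕ → Type} [∀ i, Fintype (A i)] (N : ∀ i, Matrix (A i) (A (i + 1)) ℝ) :
    Module.End ℝ (∀ i, A i → ℝ) :=
  LinearMap.pi fun i => (N i).mulVecLin ∘ₗ LinearMap.proj (i + 1)

section Shift

variable {A : ℕ → Type} [∀ i, Fintype (A i)] {N : ∀ i, Matrix (A i) (A (i + 1)) ℝ}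

@[simp]
theorem mulVecShift_apply (w : ∀ i, A i → ℝ) (i : ℕ) :
    mulVecShift N w i = (N i).mulVec (w (i + 1)) := rfl

theorem mem_V0_iff {w : ∀ i, A i → ℝ} : w ∈ V0 N ↔ 0 ≤ w ∧ mulVecShift N w = w :=
  and_congr Iff.rfl ⟨fun h => funext fun i => (h i).symm, fun h i => (congrFun h i).symm⟩

theorem continuous_mulVecShift : Continuous (mulVecShift N) :=
  continuous_pi fun i => continuous_const.matrix_mulVec (continuous_apply (i + 1))

theorem matProd_mulVec (w : ∀ i, A i → ℝ) (i m : ℕ) :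
    (matProd N i m).mulVec (w (i + m + 1)) = (mulVecShift N ^ (m + 1)) w i := by
  induction m generalizing w with
  | zero => simp [matProd]
  | succ m ih =>
    rw [pow_succ, Module.End.mul_apply, ← ih (mulVecShift N w), mulVecShift_apply,
      Matrix.mulVec_mulVec]
    rfl

theorem tendsto_pow_mulVecShift_iff {w v : ∀ i, A i → ℝ} :
    Tendsto (fun m => (mulVecShift N ^ (m + 1)) w) atTop (𝓝 v) ↔
      ∀ i, Tendsto (fun m => (matProd N i m).mulVec (w (i + m + 1))) atTop (𝓝 (v i)) := by
  simp only [tendsto_pi_nhds (f := fun m => (mulVecShift N ^ (m + 1)) w), matProd_mulVec]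

theorem mulVecShift_eq_of_tendsto {w v : ∀ i, A i → ℝ}
    (h : Tendsto (fun m => (mulVecShift N ^ (m + 1)) w) atTop (𝓝 v)) :
    mulVecShift N v = v := by
  refine tendsto_nhds_unique ((continuous_mulVecShift.tendsto v).comp h) ?_
  refine (h.comp (tendsto_add_atTop_nat 1)).congr fun m => ?_
  simp only [Function.comp_apply]
  rw [pow_succ' _ (m + 1), Module.End.mul_apply]

theorem mulVecShift_nonneg (hN : ∀ i x y, 0 ≤ N i x y) {w : ∀ i, A i → ℝ} (hw : 0 ≤ w) :
    0 ≤ mulVecShift N w := fun i x =>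
  Finset.sum_nonneg fun y _ => mul_nonneg (hN i x y) (hw (i + 1) y)

theorem pow_mulVecShift_mono (hN : ∀ i x y, 0 ≤ N i x y) (m : ℕ) :
    Monotone (mulVecShift N ^ m) := by
  have hmono : Monotone (mulVecShift N) := fun v w h => by
    rw [← sub_nonneg, ← map_sub]
    exact mulVecShift_nonneg hN (sub_nonneg.2 h)
  rw [Module.End.coe_pow]
  exact hmono.iterate m

theorem pow_mulVecShift_fixed {w : ∀ i, A i → ℝ} (h : mulVecShift N w = w) (m : ℕ) :
    (mulVecShift N ^ m) w = w := by
  rw [Module.End.coe_pow]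
  exact Function.IsFixedPt.iterate h m

/-- If `w ≤ N w` and `w` lies below a fixed point, its iterates increase to a limit. -/
theorem exists_tendsto_pow_mulVecShift (hN : ∀ i x y, 0 ≤ N i x y) {w v : ∀ i, A i → ℝ}
    (hw : w ≤ mulVecShift N w) (hv : mulVecShift N v = v) (hwv : w ≤ v) :
    ∃ l, w ≤ l ∧ l ≤ v ∧ Tendsto (fun m => (mulVecShift N ^ (m + 1)) w) atTop (𝓝 l) := by
  have hmono : Monotone fun m => (mulVecShift N ^ (m + 1)) w := by
    refine monotone_nat_of_le_succ fun m => ?_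
    rw [pow_succ _ (m + 1), Module.End.mul_apply]
    exact pow_mulVecShift_mono hN (m + 1) hw
  have hle : ∀ m, (mulVecShift N ^ (m + 1)) w ≤ v := fun m =>
    (pow_mulVecShift_mono hN (m + 1) hwv).trans_eq (pow_mulVecShift_fixed hv (m + 1))
  have hlim : Tendsto (fun m => (mulVecShift N ^ (m + 1)) w) atTop
      (𝓝 fun i a => ⨆ m, (mulVecShift N ^ (m + 1)) w i a) := by
    refine tendsto_pi_nhds.2 fun i => tendsto_pi_nhds.2 fun a => ?_
    refine tendsto_atTop_ciSup (fun m n h => hmono h i a) ⟨v i a, ?_⟩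
    rintro _ ⟨m, rfl⟩
    exact hle m i a
  refine ⟨_, ?_, le_of_tendsto' hlim hle, hlim⟩
  refine ge_of_tendsto' hlim fun m => hw.trans ?_
  simpa using hmono (Nat.zero_le m)

end Shift

section Blocks

variable {L : ℕ} {P : ℕ → Fin L → Type}

@[simp]
theorem extk_self (k : Fin L) (j : ℕ) (u : P j k → ℝ) (a : P j k) : extk k j u ⟨k, a⟩ = u a := by
  simp [extk]

theorem extk_of_ne {k k' : Fin L} (h : k' ≠ k) (j : ℕ) (u : P j k → ℝ) (a : P j k') :
    extk k j u ⟨k', a⟩ = 0 := by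
  simp [extk, h]

/-- The restriction of a sequence of vectors to its `k`-th part. -/
def blockProj (k : Fin L) :
    (∀ i, ((k' : Fin L) × P i k') → ℝ) →ₗ[ℝ] (∀ i, P i k → ℝ) where
  toFun w i a := w i ⟨k, a⟩
  map_add' _ _ := rfl
  map_smul' _ _ := rfl

@[simp]
theorem blockProj_apply (k : Fin L) (w : ∀ i, ((k' : Fin L) × P i k') → ℝ) (i : ℕ) (a : P i k) :
    blockProj k w i a = w i ⟨k, a⟩ := rfl

theorem continuous_blockProj (k : Fin L) : Continuous (blockProj (P := P) k) :=
  continuous_pi fun i => continuous_pi fun a =>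
    (continuous_apply (⟨k, a⟩ : (k' : Fin L) × P i k')).comp (continuous_apply i)

/-- The zero-extension of sequences of vectors from the `k`-th part to the full alphabets. -/
def blockExt (k : Fin L) :
    (∀ i, P i k → ℝ) →ₗ[ℝ] (∀ i, ((k' : Fin L) × P i k') → ℝ) where
  toFun u i := extk k i (u i)
  map_add' u v := by
    funext i x
    simp only [extk, Pi.add_apply]
    split_ifs <;> simp
  map_smul' c u := by
    funext i x
    simp [extk]

@[simp]
theorem blockExt_apply (k : Fin L) (u : ∀ i, P i k → ℝ) (i : ℕ) :
    blockExt k u i = extk k i (u i) := rfl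

theorem blockProj_blockExt_self (k : Fin L) (u : ∀ i, P i k → ℝ) :
    blockProj k (blockExt k u) = u := by
  funext i a
  simp

theorem blockProj_blockExt_of_ne {k j : Fin L} (h : j ≠ k) (u : ∀ i, P i k → ℝ) :
    blockProj j (blockExt k u) = 0 := by
  funext i a
  simp [extk_of_ne h]

theorem blockProj_ext {v w : ∀ i, ((k : Fin L) × P i k) → ℝ}
    (h : ∀ k, blockProj k v = blockProj k w) : v = w :=
  funext fun i => funext fun x => congrFun (congrFun (h x.1) i) x.2

theorem blockExt_le {k : Fin L} {u : ∀ i, P i k → ℝ} {v : ∀ i, ((k' : Fin L) × P i k') → ℝ}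
    (hv : 0 ≤ v) (h : u ≤ blockProj k v) : blockExt k u ≤ v := by
  rintro i ⟨j, a⟩
  rcases eq_or_ne j k with rfl | hj
  · simpa using h i a
  · simpa [extk_of_ne hj] using hv i ⟨j, a⟩

theorem blockExt_nonneg {k : Fin L} {u : ∀ i, P i k → ℝ} (hu : 0 ≤ u) : 0 ≤ blockExt k u := by
  rintro i ⟨j, a⟩
  rcases eq_or_ne j k with rfl | hj
  · simpa using hu i a
  · simp [extk_of_ne hj]

theorem sum_blockExt_apply (w : ∀ k, ∀ i, P i k → ℝ) (i : ℕ) (x : (k : Fin L) × P i k) :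
    (∑ k, blockExt k (w k)) i x = w x.1 i x.2 := by
  obtain ⟨j, a⟩ := x
  rw [Finset.sum_apply, Finset.sum_apply, Finset.sum_eq_single j]
  · simp
  · intro k _ hk
    simp [extk_of_ne hk.symm]
  · simp

theorem blockProj_sum_blockExt (w : ∀ k, ∀ i, P i k → ℝ) (k : Fin L) :
    blockProj k (∑ j, blockExt j (w j)) = w k := by
  funext i a
  rw [blockProj_apply, sum_blockExt_apply]

variable [∀ i k, Fintype (P i k)]
  {N : ∀ i, Matrix ((k : Fin L) × P i k) ((k : Fin L) × P (i + 1) k) ℝ}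

/-- The operator of the sequence `N` on the disjoint unions of the parts. -/
abbrev fullShift (N : ∀ i, Matrix ((k : Fin L) × P i k) ((k : Fin L) × P (i + 1) k) ℝ) :
    Module.End ℝ (∀ i, ((k : Fin L) × P i k) → ℝ) :=
  mulVecShift (A := fun i => (k : Fin L) × P i k) N

/-- The operator of the `k`-th diagonal block sequence of `N`. -/
abbrev blockShift (N : ∀ i, Matrix ((k : Fin L) × P i k) ((k : Fin L) × P (i + 1) k) ℝ)
    (k : Fin L) : Module.End ℝ (∀ i, P i k → ℝ) :=
  mulVecShift (A := fun i => P i k) (diagBlk N k)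

theorem blockProj_fullShift_of_lt
    (htri : ∀ i (x : (k : Fin L) × P i k) (y : (k : Fin L) × P (i + 1) k), y.1 < x.1 → N i x y = 0)
    {k : Fin L} {w : ∀ i, ((k : Fin L) × P i k) → ℝ} (hw : ∀ j, k < j → blockProj j w = 0) :
    blockProj k (fullShift N w) = blockShift N k (blockProj k w) := by
  funext i a
  simp only [blockProj_apply, mulVecShift_apply, Matrix.mulVec, dotProduct, diagBlk,
    Matrix.of_apply]
  rw [Fintype.sum_sigma, Finset.sum_eq_single k]
  · intro j _ hj
    refine Finset.sum_eq_zero fun b _ => ?_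
    rcases lt_or_gt_of_ne hj with h | h
    · rw [htri i ⟨k, a⟩ ⟨j, b⟩ h, zero_mul]
    · have := congrFun (congrFun (hw j h) (i + 1)) b
      rw [blockProj_apply] at this
      rw [this, Pi.zero_apply, Pi.zero_apply, mul_zero]
  · simp

theorem blockProj_pow_fullShift
    (htri : ∀ i (x : (k : Fin L) × P i k) (y : (k : Fin L) × P (i + 1) k), y.1 < x.1 → N i x y = 0)
    {k : Fin L} {w : ∀ i, ((k : Fin L) × P i k) → ℝ} (hw : ∀ j, k < j → blockProj j w = 0)
    (hk : blockShift N k (blockProj k w) = blockProj k w) (m : ℕ) :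
    (∀ j, k < j → blockProj j ((fullShift N ^ m) w) = 0) ∧
      blockProj k ((fullShift N ^ m) w) = blockProj k w := by
  induction m with
  | zero => exact ⟨hw, rfl⟩
  | succ m ih =>
    obtain ⟨ih₀, ih₁⟩ := ih
    rw [pow_succ', Module.End.mul_apply]
    refine ⟨fun j hj => ?_, ?_⟩
    · rw [blockProj_fullShift_of_lt htri fun j' hj' => ih₀ j' (hj.trans hj'), ih₀ j hj, map_zero]
    · rw [blockProj_fullShift_of_lt htri ih₀, ih₁, hk]

/-- The limit of the iterates keeps the topmost fixed block. -/
theorem blockProj_eq_of_tendsto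
    (htri : ∀ i (x : (k : Fin L) × P i k) (y : (k : Fin L) × P (i + 1) k), y.1 < x.1 → N i x y = 0)
    {k : Fin L} {w l : ∀ i, ((k : Fin L) × P i k) → ℝ} (hw : ∀ j, k < j → blockProj j w = 0)
    (hk : blockShift N k (blockProj k w) = blockProj k w)
    (hl : Tendsto (fun m => (fullShift N ^ (m + 1)) w) atTop (𝓝 l)) :
    (∀ j, k < j → blockProj j l = 0) ∧ blockProj k l = blockProj k w := by
  have key := fun m : ℕ => blockProj_pow_fullShift htri hw hk (m + 1)
  refine ⟨fun j hj => ?_, ?_⟩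
  · refine tendsto_nhds_unique (((continuous_blockProj j).tendsto l).comp hl) ?_
    exact tendsto_const_nhds.congr fun m => ((key m).1 j hj).symm
  · refine tendsto_nhds_unique (((continuous_blockProj k).tendsto l).comp hl) ?_
    exact tendsto_const_nhds.congr fun m => (key m).2.symm

/-- The set `V_{A_k dist}^0` of distinguished fixed-point sequences of the `k`-th block. -/
def distinguished (N : ∀ i, Matrix ((k : Fin L) × P i k) ((k : Fin L) × P (i + 1) k) ℝ)
    (k : Fin L) : Set (∀ i, P i k → ℝ) :=
  {u | u ∈ V0 (A := fun i => P i k) (diagBlk N k) ∧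
    ∃ l, Tendsto (fun m => (fullShift N ^ (m + 1)) (blockExt k u)) atTop (𝓝 l)}

theorem mem_distinguished_iff {k : Fin L} {u : ∀ i, P i k → ℝ} :
    u ∈ distinguished N k ↔ u ∈ V0 (A := fun i => P i k) (diagBlk N k) ∧
      ∀ i, ∃ v : ((k' : Fin L) × P i k') → ℝ,
        Tendsto (fun m => (matProd (A := fun j => (k' : Fin L) × P j k') N i m).mulVec
          (extk k (i + m + 1) (u (i + m + 1)))) atTop (𝓝 v) := by
  refine and_congr_right fun _ => ?_
  rw [Classical.skolem (p := fun i v =>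
    Tendsto (fun m => (matProd (A := fun j => (k' : Fin L) × P j k') N i m).mulVec
      (extk k (i + m + 1) (u (i + m + 1)))) atTop (𝓝 v))]
  exact exists_congr fun l => tendsto_pow_mulVecShift_iff

theorem add_mem_distinguished {k : Fin L} {u v : ∀ i, P i k → ℝ} (hu : u ∈ distinguished N k)
    (hv : v ∈ distinguished N k) : u + v ∈ distinguished N k := by
  obtain ⟨hu, l, hl⟩ := hu
  obtain ⟨hv, l', hl'⟩ := hv
  rw [mem_V0_iff] at hu hv
  refine ⟨mem_V0_iff.2 ⟨add_nonneg hu.1 hv.1, ?_⟩, l + l', ?_⟩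
  · rw [map_add, hu.2, hv.2]
  · simpa only [map_add] using hl.add hl'

theorem zero_mem_distinguished (k : Fin L) : (0 : ∀ i, P i k → ℝ) ∈ distinguished N k :=
  ⟨mem_V0_iff.2 ⟨le_rfl, map_zero _⟩, 0, by simp⟩

theorem exists_tendsto_sum {w : ∀ k, ∀ i, P i k → ℝ} (hN : ∀ i x y, 0 ≤ N i x y)
    (hw : ∀ k, w k ∈ distinguished N k) :
    ∃ v ∈ V0 N,
      Tendsto (fun m => (fullShift N ^ (m + 1)) (∑ k, blockExt k (w k))) atTop (𝓝 v) := by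
  choose l hl using fun k => (hw k).2
  have hlim : Tendsto (fun m => (fullShift N ^ (m + 1)) (∑ k, blockExt k (w k))) atTop
      (𝓝 (∑ k, l k)) := by
    simpa only [map_sum] using tendsto_finsetSum Finset.univ fun k _ => hl k
  refine ⟨_, mem_V0_iff.2 ⟨ge_of_tendsto' hlim fun m => ?_, mulVecShift_eq_of_tendsto hlim⟩, hlim⟩
  rw [← map_zero (fullShift N ^ (m + 1))]
  exact pow_mulVecShift_mono hN (m + 1)
    (Finset.sum_nonneg fun k _ => blockExt_nonneg (mem_V0_iff.1 (hw k).1).1)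

/-- The block components are determined by the limit of the iterates of their sum. -/
theorem eq_of_tendsto_sum
    (htri : ∀ i (x : (k : Fin L) × P i k) (y : (k : Fin L) × P (i + 1) k), y.1 < x.1 → N i x y = 0)
    {w w' : ∀ k, ∀ i, P i k → ℝ} {v : ∀ i, ((k : Fin L) × P i k) → ℝ}
    (hw : ∀ k, blockShift N k (w k) = w k) (hw' : ∀ k, blockShift N k (w' k) = w' k)
    (h : Tendsto (fun m => (fullShift N ^ (m + 1)) (∑ k, blockExt k (w k))) atTop (𝓝 v))
    (h' : Tendsto (fun m => (fullShift N ^ (m + 1)) (∑ k, blockExt k (w' k))) atTop (𝓝 v)) :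
    w = w' := by
  have hd : Tendsto (fun m => (fullShift N ^ (m + 1)) (∑ k, blockExt k ((w - w') k))) atTop
      (𝓝 0) := by
    simpa only [Pi.sub_apply, map_sub, Finset.sum_sub_distrib, sub_self] using h.sub h'
  funext k
  induction k using WellFoundedGT.induction with
  | ind k ih =>
    have hz : ∀ j, k < j → blockProj j (∑ k, blockExt k ((w - w') k)) = 0 := fun j hj => by
      rw [blockProj_sum_blockExt, Pi.sub_apply, ih j hj, sub_self]
    have hk := (blockProj_eq_of_tendsto htri hz (by
      rw [blockProj_sum_blockExt, Pi.sub_apply, map_sub, hw, hw']) hd).2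
    rw [blockProj_sum_blockExt, map_zero] at hk
    exact sub_eq_zero.1 hk.symm

/-- Every nonnegative fixed-point sequence is obtained from distinguished ones by peeling off the
blocks from the last to the first. -/
theorem exists_distinguished_tendsto (hN : ∀ i x y, 0 ≤ N i x y)
    (htri : ∀ i (x : (k : Fin L) × P i k) (y : (k : Fin L) × P (i + 1) k), y.1 < x.1 → N i x y = 0)
    (n : ℕ) {v : ∀ i, ((k : Fin L) × P i k) → ℝ} (hv : v ∈ V0 N)
    (hn : ∀ j : Fin L, n ≤ j → blockProj j v = 0) :
    ∃ w : ∀ k, ∀ i, P i k → ℝ, (∀ k, w k ∈ distinguished N k) ∧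
      Tendsto (fun m => (fullShift N ^ (m + 1)) (∑ k, blockExt k (w k))) atTop (𝓝 v) := by
  induction n generalizing v with
  | zero =>
    obtain rfl : v = 0 := blockProj_ext fun k => by rw [hn k (Nat.zero_le _), map_zero]
    exact ⟨0, fun k => zero_mem_distinguished k, by simp⟩
  | succ n ih =>
    by_cases hnL : n < L
    swap
    · exact ih hv fun j hj => absurd j.2 (by omega)
    have hv' := mem_V0_iff.1 hv
    set k : Fin L := ⟨n, hnL⟩
    set u := blockProj k v with hu
    have hu0 : 0 ≤ u := fun i a => hv'.1 i ⟨k, a⟩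
    have hzv : ∀ j, k < j → blockProj j v = 0 := fun j hj => hn j hj
    have hfix : blockShift N k u = u := by
      rw [hu, ← blockProj_fullShift_of_lt htri hzv]
      exact congrArg _ hv'.2
    have hzu : ∀ j, k < j → blockProj j (blockExt k u) = 0 := fun j hj =>
      blockProj_blockExt_of_ne hj.ne' u
    have hself := blockProj_blockExt_self k u
    have hincr : blockExt k u ≤ fullShift N (blockExt k u) := by
      refine blockExt_le (mulVecShift_nonneg hN (blockExt_nonneg hu0)) ?_
      rw [blockProj_fullShift_of_lt htri hzu, hself, hfix]
    obtain ⟨l, -, hlv, hlim⟩ := exists_tendsto_pow_mulVecShift hN hincr hv'.2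
      (blockExt_le hv'.1 le_rfl)
    obtain ⟨hl0, hlk⟩ := blockProj_eq_of_tendsto htri hzu (by rw [hself, hfix]) hlim
    obtain ⟨w, hw, hwlim⟩ := ih (v := v - l)
      (mem_V0_iff.2 ⟨sub_nonneg.2 hlv, by
        rw [map_sub, hv'.2, mulVecShift_eq_of_tendsto hlim]⟩) fun j hj => by
      rcases hj.eq_or_lt with h | h
      · obtain rfl : j = k := Fin.ext h.symm
        rw [map_sub, hlk, hself, hu, sub_self]
      · rw [map_sub, hzv j h, hl0 j h, sub_zero]
    have hsingle : ∀ j, (Pi.single k u : ∀ k, ∀ i, P i k → ℝ) j ∈ distinguished N j := fun j => by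
      rcases eq_or_ne j k with rfl | hj
      · rw [Pi.single_eq_same]
        exact ⟨mem_V0_iff.2 ⟨hu0, hfix⟩, l, hlim⟩
      · rw [Pi.single_eq_of_ne hj]
        exact zero_mem_distinguished j
    have hsum : ∑ j, blockExt j ((Pi.single k u : ∀ k, ∀ i, P i k → ℝ) j) = blockExt k u := by
      rw [Finset.sum_eq_single k, Pi.single_eq_same]
      · intro j _ hj
        rw [Pi.single_eq_of_ne hj, map_zero]
      · simp
    refine ⟨w + Pi.single k u, fun j => add_mem_distinguished (hw j) (hsingle j), ?_⟩
    simpa only [Pi.add_apply, map_add, Finset.sum_add_distrib, hsum, sub_add_cancel]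
      using hwlim.add hlim

end Blocks

/-- for a column-reduced sequence `N` of nonnegative real matrices, upper
triangular with respect to a partition of the alphabets into `L` parts, with every diagonal
block sequence either column-reduced and primitive or identically zero, the map
`I(w_1, …, w_L) = ι(w_1) + ⋯ + ι(w_L)` is a bijection from `∏_k V_{A_k dist}^0` onto
`V_N^0` (here `I` is characterized by the convergence of the iterates of `N` applied to the
combined zero-extensions). -/
theorem statement2 (L : ℕ) (P : ℕ → Fin L → Type)
    [∀ i k, Fintype (P i k)] [∀ i, Nonempty ((k : Fin L) × P i k)]
    (N : ∀ i, Matrix ((k : Fin L) × P i k) ((k : Fin L) × P (i + 1) k) ℝ)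
    (hN0 : ∀ i x y, 0 ≤ N i x y)
    (hcolN : ∀ i (y : (k : Fin L) × P (i + 1) k), ∃ x, N i x y ≠ 0)
    (htri : ∀ i (x : (k : Fin L) × P i k) (y : (k : Fin L) × P (i + 1) k),
      y.1 < x.1 → N i x y = 0)
    (hdiag : ∀ k : Fin L,
      ((∀ i (b : P (i + 1) k), ∃ a : P i k, diagBlk N k i a b ≠ 0) ∧
        Primitive (A := fun i => P i k) (diagBlk N k)) ∨
      (∀ i (a : P i k) (b : P (i + 1) k), diagBlk N k i a b = 0)) :
    ∃ I : (∀ k : Fin L, {u : ∀ i, P i k → ℝ //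
            u ∈ V0 (A := fun i => P i k) (diagBlk N k) ∧
            ∀ i, ∃ v : ((k' : Fin L) × P i k') → ℝ,
              Tendsto (fun m =>
                  (matProd (A := fun j => (k' : Fin L) × P j k') N i m).mulVec
                    (extk k (i + m + 1) (u (i + m + 1)))) atTop (𝓝 v)}) →
          {v : ∀ i, ((k : Fin L) × P i k) → ℝ // v ∈ V0 N},
      Function.Bijective I ∧
      ∀ w, ∀ i, Tendsto (fun m =>
          (matProd (A := fun j => (k' : Fin L) × P j k') N i m).mulVec
            (fun x => (w x.1).1 (i + m + 1) x.2)) atTop (𝓝 ((I w).1 i)) := by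
  have hiff (w : ∀ k, ∀ i, P i k → ℝ) (v : ∀ i, ((k : Fin L) × P i k) → ℝ) :
      Tendsto (fun m => (fullShift N ^ (m + 1)) (∑ k, blockExt k (w k))) atTop (𝓝 v) ↔
        ∀ i, Tendsto (fun m => (matProd (A := fun j => (k' : Fin L) × P j k') N i m).mulVec
          (fun x => w x.1 (i + m + 1) x.2)) atTop (𝓝 (v i)) := by
    have hw : (∑ k, blockExt k (w k)) = fun i x => w x.1 i x.2 :=
      funext fun i => funext fun x => sum_blockExt_apply w i x
    rw [hw]
    exact tendsto_pow_mulVecShift_iff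
  choose I hI hlim using fun w : ∀ k : Fin L, {u : ∀ i, P i k → ℝ //
      u ∈ V0 (A := fun i => P i k) (diagBlk N k) ∧
      ∀ i, ∃ v : ((k' : Fin L) × P i k') → ℝ,
        Tendsto (fun m => (matProd (A := fun j => (k' : Fin L) × P j k') N i m).mulVec
          (extk k (i + m + 1) (u (i + m + 1)))) atTop (𝓝 v)} =>
    exists_tendsto_sum hN0 fun k => mem_distinguished_iff.2 (w k).2
  refine ⟨fun w => ⟨I w, hI w⟩, ⟨fun w w' h => ?_, fun v => ?_⟩, fun w => (hiff _ _).1 (hlim w)⟩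
  · have hII : I w = I w' := congrArg Subtype.val h
    have := eq_of_tendsto_sum htri (fun k => (mem_V0_iff.1 (w k).2.1).2)
      (fun k => (mem_V0_iff.1 (w' k).2.1).2) (hII ▸ hlim w) (hlim w')
    exact funext fun k => Subtype.ext (congrFun this k)
  · obtain ⟨w, hw, hwv⟩ := exists_distinguished_tendsto hN0 htri L v.2
      fun j hj => absurd j.2 (not_lt.2 hj)
    refine ⟨fun k => ⟨w k, mem_distinguished_iff.1 (hw k)⟩, Subtype.ext ?_⟩
    exact tendsto_nhds_unique (hlim _) hwv
end
end

section
/- Let N = (N_i)_{i≥0} be a column-reduced sequence of nonnegative real matrices with nonempty alphabets. Then N is primitive if and only if V_N^Δ ≠ ∅ and every w ∈ V_N^Δ satisfies (w_i)_a > 0 for all i ≥ 0 and all a ∈ A_i. -/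
open Filter Topology Matrix

noncomputable section

/-- `u i` is the normalization of `N i *ᵥ u (i + 1)`, stated without division. -/
def IsProjectiveFixed {A : ℕ → Type} [∀ i, Fintype (A i)]
    (N : ∀ i, Matrix (A i) (A (i + 1)) ℝ) (u : ∀ i, A i → ℝ) (i : ℕ) : Prop :=
  N i *ᵥ u (i + 1) = (∑ a, (N i *ᵥ u (i + 1)) a) • u i

theorem mulVec_nonneg_of_nonneg {m n : Type*} [Fintype n] {M : Matrix m n ℝ}
    (hM : ∀ a b, 0 ≤ M a b) {v : n → ℝ} (hv : ∀ b, 0 ≤ v b) (a : m) : 0 ≤ (M *ᵥ v) a :=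
  Finset.sum_nonneg fun b _ => mul_nonneg (hM a b) (hv b)

theorem sum_mulVec_pos {m n : Type*} [Fintype m] [Fintype n] {M : Matrix m n ℝ}
    (hM : ∀ a b, 0 ≤ M a b) (hcol : ∀ b, ∃ a, M a b ≠ 0) {v : n → ℝ}
    (hv : v ∈ stdSimplex ℝ n) : 0 < ∑ a, (M *ᵥ v) a := by
  obtain ⟨b, -, hb⟩ : ∃ b ∈ Finset.univ, 0 < v b :=
    Finset.exists_lt_of_sum_lt (f := fun _ => (0 : ℝ)) (by simp [hv.2])
  obtain ⟨a, ha⟩ := hcol b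
  refine Finset.sum_pos' (fun a _ => mulVec_nonneg_of_nonneg hM hv.1 a)
    ⟨a, Finset.mem_univ a, ?_⟩
  exact Finset.sum_pos' (fun b _ => mul_nonneg (hM a b) (hv.1 b))
    ⟨b, Finset.mem_univ b, mul_pos ((hM a b).lt_of_ne' ha) hb⟩

section

variable {A : ℕ → Type} [∀ i, Fintype (A i)] {N : ∀ i, Matrix (A i) (A (i + 1)) ℝ}

theorem isClosed_setOf_isProjectiveFixed (i : ℕ) :
    IsClosed {u | IsProjectiveFixed N u i} := by
  unfold IsProjectiveFixed
  have h : Continuous fun u : ∀ i, A i → ℝ => N i *ᵥ u (i + 1) :=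
    continuous_const.matrix_mulVec (continuous_apply (i + 1))
  have hsum : Continuous fun u : ∀ i, A i → ℝ => ∑ a, (N i *ᵥ u (i + 1)) a :=
    continuous_finsetSum _ fun a _ => (continuous_apply a).comp h
  exact isClosed_eq h (hsum.smul (continuous_apply i))

theorem exists_isProjectiveFixed_of_lt [∀ i, Nonempty (A i)] (hN : ∀ i a b, 0 ≤ N i a b)
    (hcol : ∀ i (b : A (i + 1)), ∃ a, N i a b ≠ 0) (n : ℕ) {v : A n → ℝ}
    (hv : v ∈ stdSimplex ℝ (A n)) :
    ∃ u : ∀ i, A i → ℝ, (∀ i, u i ∈ stdSimplex ℝ (A i)) ∧ u n = v ∧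
      ∀ i < n, IsProjectiveFixed N u i := by
  classical
  induction n with
  | zero =>
    refine ⟨Function.update (fun i => Pi.single (Classical.arbitrary (A i)) 1) 0 v,
      fun i => ?_, by simp, by simp⟩
    rcases eq_or_ne i 0 with rfl | hi
    · simpa using hv
    · simpa [hi] using single_mem_stdSimplex ℝ (Classical.arbitrary (A i))
  | succ n ih =>
    have hs := sum_mulVec_pos (hN n) (hcol n) hv
    obtain ⟨u, hu, hun, hfix⟩ := ih (v := (∑ a, (N n *ᵥ v) a)⁻¹ • (N n *ᵥ v))
      ⟨fun a => mul_nonneg (inv_nonneg.2 hs.le) (mulVec_nonneg_of_nonneg (hN n) hv.1 a), by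
        simp only [Pi.smul_apply, smul_eq_mul, ← Finset.mul_sum]
        exact inv_mul_cancel₀ hs.ne'⟩
    refine ⟨Function.update u (n + 1) v, fun i => ?_, by simp, fun i hi => ?_⟩
    · rcases eq_or_ne i (n + 1) with rfl | h
      · simpa using hv
      · simpa [h] using hu i
    · unfold IsProjectiveFixed
      rcases Nat.lt_succ_iff_lt_or_eq.1 hi with h | rfl
      · rw [Function.update_of_ne (by omega), Function.update_of_ne (by omega)]
        exact hfix i h
      · rw [Function.update_self, Function.update_of_ne (by omega), hun, smul_smul,
          mul_inv_cancel₀ hs.ne', one_smul]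

theorem exists_matProd_mulVec_eq_smul (hN : ∀ i a b, 0 ≤ N i a b)
    (hcol : ∀ i (b : A (i + 1)), ∃ a, N i a b ≠ 0) {u : ∀ i, A i → ℝ}
    (hu : ∀ i, u i ∈ stdSimplex ℝ (A i)) (k m : ℕ)
    (hfix : ∀ i < k + m + 1, IsProjectiveFixed N u i) :
    ∃ c : ℝ, 0 < c ∧ matProd N k m *ᵥ u (k + m + 1) = c • u k := by
  induction m with
  | zero => exact ⟨_, sum_mulVec_pos (hN k) (hcol k) (hu _), hfix k (by omega)⟩
  | succ m ih =>
    obtain ⟨c, hc, h⟩ := ih fun i hi => hfix i (by omega)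
    refine ⟨_, mul_pos (sum_mulVec_pos (hN (k + m + 1)) (hcol _) (hu _)) hc, ?_⟩
    change (matProd N k m * N (k + m + 1)) *ᵥ u (k + m + 1 + 1) = _
    have hlast : N (k + m + 1) *ᵥ u (k + m + 1 + 1) = _ := hfix (k + m + 1) (by omega)
    rw [← mulVec_mulVec, ← smul_smul, ← h, ← mulVec_smul]
    exact congrArg _ hlast

theorem exists_mem_VDelta_of_isProjectiveFixed (hN : ∀ i a b, 0 ≤ N i a b)
    (hcol : ∀ i (b : A (i + 1)), ∃ a, N i a b ≠ 0) {u : ∀ i, A i → ℝ}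
    (hu : ∀ i, u i ∈ stdSimplex ℝ (A i)) (hfix : ∀ i, IsProjectiveFixed N u i) :
    ∃ c : ℕ → ℝ, (fun i => c i • u i) ∈ VDelta N := by
  have hs i := sum_mulVec_pos (hN i) (hcol i) (hu (i + 1))
  let c : ℕ → ℝ := fun n => ∏ i ∈ Finset.range n, (∑ a, (N i *ᵥ u (i + 1)) a)⁻¹
  have hc n : 0 < c n := Finset.prod_pos fun i _ => inv_pos.2 (hs i)
  refine ⟨c, ⟨⟨fun i a => mul_nonneg (hc i).le ((hu i).1 a), fun i => ?_⟩, fun i h => ?_⟩, ?_⟩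
  · change c i • u i = N i *ᵥ (c (i + 1) • u (i + 1))
    rw [mulVec_smul, hfix i, smul_smul]
    congr 1
    simp only [c, Finset.prod_range_succ]
    rw [mul_assoc, inv_mul_cancel₀ (hs i).ne', mul_one]
  · have h0 : u i = 0 := (smul_eq_zero.1 h).resolve_left (hc i).ne'
    simpa [h0] using (hu i).2
  · simp [c, abs_of_nonneg ((hu 0).1 _), (hu 0).2]

theorem exists_isProjectiveFixed_mem_of_isClosed {k : ℕ} {P : Set (A k → ℝ)} (hP : IsClosed P)
    (h : ∀ n, ∃ u : ∀ i, A i → ℝ, (∀ i, u i ∈ stdSimplex ℝ (A i)) ∧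
      (∀ i < n, IsProjectiveFixed N u i) ∧ u k ∈ P) :
    ∃ u : ∀ i, A i → ℝ, (∀ i, u i ∈ stdSimplex ℝ (A i)) ∧
      (∀ i, IsProjectiveFixed N u i) ∧ u k ∈ P := by
  let K : ℕ → Set (∀ i, A i → ℝ) := fun n => Set.univ.pi (fun i => stdSimplex ℝ (A i)) ∩
    ((⋂ i < n, {u | IsProjectiveFixed N u i}) ∩ (fun u => u k) ⁻¹' P)
  have hcomp : IsCompact (Set.univ.pi fun i => stdSimplex ℝ (A i)) :=
    isCompact_univ_pi fun i => isCompact_stdSimplex ℝ (A i)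
  have hclosed n : IsClosed ((⋂ i < n, {u | IsProjectiveFixed N u i}) ∩ (fun u => u k) ⁻¹' P) :=
    (isClosed_biInter fun i _ => isClosed_setOf_isProjectiveFixed i).inter
      (hP.preimage (continuous_apply k))
  obtain ⟨u, hu⟩ := IsCompact.nonempty_iInter_of_sequence_nonempty_isCompact_isClosed K
    (fun n u ⟨hu, hfix, huP⟩ => ⟨hu, by
      simp only [Set.mem_iInter] at hfix ⊢
      exact fun i hi => hfix i (by omega), huP⟩)
    (fun n => by
      obtain ⟨u, hu, hfix, huP⟩ := h n
      exact ⟨u, fun i _ => hu i, by simpa using hfix, huP⟩)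
    (hcomp.inter_right (hclosed 0)) (fun n => hcomp.isClosed.inter (hclosed n))
  rw [Set.mem_iInter] at hu
  refine ⟨u, fun i => (hu 0).1 i trivial, fun i => ?_, (hu 0).2.2⟩
  have := (hu (i + 1)).2.1
  simp only [Set.mem_iInter] at this
  exact this i (by omega)

theorem matProd_mulVec_eq_of_mem_V0 {w : ∀ i, A i → ℝ} (hw : w ∈ V0 N) (k m : ℕ) :
    matProd N k m *ᵥ w (k + m + 1) = w k := by
  induction m with
  | zero => exact (hw.2 k).symm
  | succ m ih =>
    change (matProd N k m * N (k + m + 1)) *ᵥ w (k + m + 1 + 1) = _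
    rw [← mulVec_mulVec, ← hw.2, ih]

theorem VDelta_nonempty [∀ i, Nonempty (A i)] (hN : ∀ i a b, 0 ≤ N i a b)
    (hcol : ∀ i (b : A (i + 1)), ∃ a, N i a b ≠ 0) : (VDelta N).Nonempty := by
  classical
  obtain ⟨u, hu, hfix, -⟩ := exists_isProjectiveFixed_mem_of_isClosed (N := N) (k := 0)
    isClosed_univ fun n => by
      obtain ⟨u, hu, -, hfix⟩ := exists_isProjectiveFixed_of_lt hN hcol n
        (single_mem_stdSimplex ℝ (Classical.arbitrary (A n)))
      exact ⟨u, hu, hfix, trivial⟩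
  obtain ⟨c, hc⟩ := exists_mem_VDelta_of_isProjectiveFixed hN hcol hu hfix
  exact ⟨_, hc⟩

theorem Primitive.pos_of_mem_Vpos (h : Primitive N) {w : ∀ i, A i → ℝ} (hw : w ∈ Vpos N)
    (i : ℕ) (a : A i) : 0 < w i a := by
  obtain ⟨m, -, hm⟩ := h i
  obtain ⟨b, hb⟩ := Function.ne_iff.1 (hw.2 (i + m + 1))
  rw [← matProd_mulVec_eq_of_mem_V0 hw.1 i m]
  exact Finset.sum_pos' (fun b _ => mul_nonneg (hm a b).le (hw.1.1 _ b))
    ⟨b, Finset.mem_univ b, mul_pos (hm a b) ((hw.1.1 _ b).lt_of_ne' hb)⟩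

theorem exists_mem_VDelta_eq_zero_of_not_primitive [∀ i, Nonempty (A i)]
    (hN : ∀ i a b, 0 ≤ N i a b) (hcol : ∀ i (b : A (i + 1)), ∃ a, N i a b ≠ 0)
    (h : ¬ Primitive N) : ∃ w ∈ VDelta N, ∃ i a, w i a = 0 := by
  classical
  unfold Primitive at h
  push Not at h
  obtain ⟨k, hk⟩ := h
  have hP : IsClosed {v : A k → ℝ | ∏ a, v a = 0} :=
    isClosed_eq (continuous_finsetProd _ fun a _ => continuous_apply a) continuous_const
  obtain ⟨u, hu, hfix, huk⟩ := exists_isProjectiveFixed_mem_of_isClosed (N := N) hP fun n => by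
    obtain ⟨a, b, hab⟩ := hk (n + 1) n.succ_pos
    obtain ⟨u, hu, hub, hfix⟩ := exists_isProjectiveFixed_of_lt hN hcol (k + (n + 1) + 1)
      (single_mem_stdSimplex ℝ b)
    refine ⟨u, hu, fun i hi => hfix i (by omega), Finset.prod_eq_zero (Finset.mem_univ a) ?_⟩
    obtain ⟨c, hc, hcu⟩ := exists_matProd_mulVec_eq_smul hN hcol hu k (n + 1) hfix
    have hz := congrFun hcu a
    rw [hub, mulVec_single_one, col_apply, hab.antisymm (matProd_nonneg hN k (n + 1) a b)] at hz
    exact (mul_eq_zero.1 hz.symm).resolve_left hc.ne'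
  obtain ⟨c, hc⟩ := exists_mem_VDelta_of_isProjectiveFixed hN hcol hu hfix
  obtain ⟨a, -, ha⟩ := Finset.prod_eq_zero_iff.1 huk
  exact ⟨_, hc, k, a, by simp [ha]⟩

end

/-- for a column-reduced sequence `N` of nonnegative real matrices with nonempty
alphabets, `N` is primitive if and only if `V_N^Δ` is nonempty and every `w ∈ V_N^Δ` is
strictly positive in every entry at every time. -/
theorem statement8 (A : ℕ → Type) [∀ i, Fintype (A i)] [∀ i, Nonempty (A i)]
    (N : ∀ i, Matrix (A i) (A (i + 1)) ℝ) (hN : ∀ i a b, 0 ≤ N i a b)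
    (hcol : ∀ i (b : A (i + 1)), ∃ a, N i a b ≠ 0) :
    Primitive N ↔ ((VDelta N).Nonempty ∧ ∀ w ∈ VDelta N, ∀ i a, 0 < w i a) := by
  refine ⟨fun h => ⟨VDelta_nonempty hN hcol, fun w hw => h.pos_of_mem_Vpos hw.1⟩, ?_⟩
  rintro ⟨-, hpos⟩
  by_contra h
  obtain ⟨w, hw, i, a, ha⟩ := exists_mem_VDelta_eq_zero_of_not_primitive hN hcol h
  exact (hpos w hw i a).ne' ha
end
end

section
/- Let M = (M_i)_{i≥0} be a primitive sequence of nonnegative integer matrices and let ν be a Borel measure on the edge path space Σ_M^{0,+} such that any two nonempty thin cylinders [e_0 … e_n] and [f_0 … f_n] of the same length with e_n⁺ = f_n⁺ have equal ν-measure. If ν is positive and finite on some nonempty open subset of Σ_M^{0,+}, then ν is positive and finite on every nonempty open subset; if ν is infinite on some nonempty open subset, then ν is infinite on every nonempty open subset. -/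
open Filter Topology Matrix

noncomputable section

/-- The edge path space `Σ_M^{0,+}` of a Bratteli diagram given by edge sets `E i` with
source maps `src` and range maps `rng`: the set of infinite edge paths, as a subspace of the
product `∏ i, E i`. -/
abbrev EdgePathSpace {A : ℕ → Type} (E : ℕ → Type)
    (src : ∀ i, E i → A i) (rng : ∀ i, E i → A (i + 1)) : Type :=
  ↥{e : ∀ i, E i | ∀ i, rng i (e i) = src (i + 1) (e (i + 1))}

/-- The thin cylinder `[x_0 … x_n]` of a finite edge word (given as the first `n+1` letters of
`x`): the paths agreeing with `x` up to time `n`. -/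
def thinCyl {A : ℕ → Type} {E : ℕ → Type}
    (src : ∀ i, E i → A i) (rng : ∀ i, E i → A (i + 1)) (x : ∀ i, E i) (n : ℕ) :
    Set (EdgePathSpace E src rng) :=
  {p | ∀ i, i ≤ n → (p : ∀ i, E i) i = x i}

/-- The word `x_0 … x_n` is allowed: consecutive edges match. -/
def AllowedWord {A : ℕ → Type} {E : ℕ → Type}
    (src : ∀ i, E i → A i) (rng : ∀ i, E i → A (i + 1)) (x : ∀ i, E i) (n : ℕ) : Prop :=
  ∀ i, i < n → rng i (x i) = src (i + 1) (x (i + 1))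

/-- A positive entry of `M_k ⋯ M_{k+m}` lets one prepend a finite path starting at `a` to an
infinite path `q` starting at `b`. -/
theorem exists_path_of_matProd_pos {A : ℕ → Type} [∀ i, Fintype (A i)]
    {M : ∀ i, Matrix (A i) (A (i + 1)) ℝ} {E : ℕ → Type}
    {src : ∀ i, E i → A i} {rng : ∀ i, E i → A (i + 1)}
    (hM : ∀ i a b, M i a b = (Nat.card {e : E i // src i e = a ∧ rng i e = b} : ℝ))
    (k m : ℕ) (a : A k) (b : A (k + m + 1)) (hpos : 0 < matProd M k m a b)
    (q : ∀ i, E i) (hb : src (k + m + 1) (q (k + m + 1)) = b)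
    (hq : ∀ i, k + m < i → rng i (q i) = src (i + 1) (q (i + 1))) :
    ∃ r : ∀ i, E i, src k (r k) = a ∧ (∀ i, k ≤ i → rng i (r i) = src (i + 1) (r (i + 1))) ∧
      ∀ i, k + m < i → r i = q i := by
  classical
  have edge : ∀ i c d, 0 < M i c d → ∃ e : E i, src i e = c ∧ rng i e = d := by
    intro i c d h
    rw [hM, Nat.cast_pos] at h
    obtain ⟨⟨e, he⟩⟩ := (Nat.card_pos_iff.1 h).1
    exact ⟨e, he⟩
  have update_path : ∀ (j : ℕ) (e : E j) (q : ∀ i, E i),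
      rng j e = src (j + 1) (q (j + 1)) →
      (∀ i, j < i → rng i (q i) = src (i + 1) (q (i + 1))) →
      ∀ i, j ≤ i → rng i (Function.update q j e i) =
        src (i + 1) (Function.update q j e (i + 1)) := by
    intro j e q he hq i hi
    rcases hi.eq_or_lt with rfl | hi
    · rw [Function.update_self, Function.update_of_ne (by omega), he]
    · rw [Function.update_of_ne (by omega), Function.update_of_ne (by omega), hq i hi]
  induction m generalizing q with
  | zero =>
    obtain ⟨e, hea, heb⟩ := edge k a b hpos
    refine ⟨Function.update q k e, by rw [Function.update_self, hea],
      update_path k e q (heb.trans hb.symm) hq, fun i hi => Function.update_of_ne (by omega) _ _⟩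
  | succ m ih =>
    have hsum : 0 < ∑ c, matProd M k m a c * M (k + m + 1) c b := hpos
    obtain ⟨c, -, hc⟩ := Finset.exists_lt_of_sum_lt
      (f := fun _ => (0 : ℝ)) (by simpa using hsum)
    have hnonneg : 0 ≤ M (k + m + 1) c b := by rw [hM]; positivity
    have hMpos : 0 < M (k + m + 1) c b :=
      hnonneg.lt_of_ne fun h => by simp [← h] at hc
    obtain ⟨e, hec, heb⟩ := edge (k + m + 1) c b hMpos
    obtain ⟨r, hra, hr, hrq⟩ := ih c (pos_of_mul_pos_left hc hnonneg)
      (Function.update q (k + m + 1) e) (by rw [Function.update_self, hec])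
      (fun i hi => update_path (k + m + 1) e q (heb.trans hb.symm)
        (fun i hi => hq i (by omega)) i (by omega))
    exact ⟨r, hra, hr, fun i hi => by
      rw [hrq i (by omega), Function.update_of_ne (by omega)]⟩

/-- In a primitive diagram, initial segments of length `k` and tails beyond some `n = n(k)` can be
prescribed independently. -/
theorem exists_splice_of_primitive {A : ℕ → Type} [∀ i, Fintype (A i)]
    {M : ∀ i, Matrix (A i) (A (i + 1)) ℝ} {E : ℕ → Type}
    {src : ∀ i, E i → A i} {rng : ∀ i, E i → A (i + 1)}
    (hM : ∀ i a b, M i a b = (Nat.card {e : E i // src i e = a ∧ rng i e = b} : ℝ))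
    (hprim : Primitive M) (k : ℕ) :
    ∃ n, k ≤ n ∧ ∀ p q : EdgePathSpace E src rng, ∃ r : EdgePathSpace E src rng,
      (∀ i, i ≤ k → r.1 i = p.1 i) ∧ ∀ i, n < i → r.1 i = q.1 i := by
  obtain ⟨m, -, hpos⟩ := hprim (k + 1)
  refine ⟨k + 1 + m, by omega, fun p q => ?_⟩
  obtain ⟨r, hrk, hr, hrq⟩ := exists_path_of_matProd_pos hM (k + 1) m (rng k (p.1 k)) _
    (hpos _ _) q.1 rfl fun i _ => q.2 i
  refine ⟨⟨fun i => if i ≤ k then p.1 i else r i, fun i => ?_⟩, fun i hi => if_pos hi,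
    fun i hi => ?_⟩
  · rcases lt_trichotomy i k with hi | rfl | hi
    · simpa only [if_pos hi.le, if_pos (show i + 1 ≤ k from hi)] using p.2 i
    · simpa using hrk.symm
    · simpa only [if_neg (show ¬ i ≤ k by omega), if_neg (show ¬ i + 1 ≤ k by omega)]
        using hr i hi
  · simpa only [if_neg (show ¬ i ≤ k by omega)] using hrq i hi

/-- Every neighbourhood in the edge path space contains a thin cylinder. -/
theorem exists_thinCyl_subset {A : ℕ → Type} {E : ℕ → Type} [∀ i, TopologicalSpace (E i)]
    {src : ∀ i, E i → A i} {rng : ∀ i, E i → A (i + 1)} {U : Set (EdgePathSpace E src rng)}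
    (hU : IsOpen U) {p : EdgePathSpace E src rng} (hp : p ∈ U) :
    ∃ k, thinCyl src rng p.1 k ⊆ U := by
  obtain ⟨V, hV, rfl⟩ := isOpen_induced_iff.1 hU
  obtain ⟨I, u, hu, hsub⟩ := isOpen_pi_iff.1 hV p.1 hp
  refine ⟨I.sup id, fun r hr => hsub fun i hi => ?_⟩
  rw [hr i (Finset.le_sup (f := id) hi)]
  exact (hu i hi).2

/-- The thin cylinders of a given length form a finite cover, so a bound on their masses bounds the
total mass. -/
theorem measure_univ_le_of_thinCyl_le {A : ℕ → Type} {E : ℕ → Type} [∀ i, Finite (E i)]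
    [∀ i, MeasurableSpace (E i)] {src : ∀ i, E i → A i} {rng : ∀ i, E i → A (i + 1)}
    (ν : MeasureTheory.Measure (EdgePathSpace E src rng)) (n : ℕ) :
    ∃ N : ℕ, ∀ c, (∀ q : EdgePathSpace E src rng, ν (thinCyl src rng q.1 n) ≤ c) →
      ν Set.univ ≤ N * c := by
  have := Fintype.ofFinite (∀ i : Fin (n + 1), E i)
  refine ⟨Fintype.card (∀ i : Fin (n + 1), E i), fun c hc => ?_⟩
  let C : (∀ i : Fin (n + 1), E i) → Set (EdgePathSpace E src rng) :=
    fun f => {p | ∀ i : Fin (n + 1), p.1 i = f i}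
  have hC : ∀ f, ν (C f) ≤ c := by
    intro f
    rcases (C f).eq_empty_or_nonempty with h | ⟨q, hq⟩
    · simp [h]
    · refine (MeasureTheory.measure_mono fun p hp i hi => ?_).trans (hc q)
      exact (hp ⟨i, by omega⟩).trans (hq ⟨i, by omega⟩).symm
  calc ν Set.univ ≤ ν (⋃ f, C f) := MeasureTheory.measure_mono fun p _ =>
        Set.mem_iUnion.2 ⟨fun i => p.1 i, fun _ => rfl⟩
    _ ≤ ∑ f, ν (C f) := MeasureTheory.measure_iUnion_fintype_le ν C
    _ ≤ ∑ _f : (∀ i : Fin (n + 1), E i), c := Finset.sum_le_sum fun f _ => hC f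
    _ = _ := by simp

/-- let `M` be a primitive sequence of nonnegative integer matrices, realized by
a Bratteli diagram, and `ν` a Borel measure on `Σ_M^{0,+}` giving equal mass to any two
nonempty thin cylinders of the same length with the same final range vertex.  If `ν` is
positive and finite on some nonempty open set then it is so on every nonempty open set, and if
`ν` is infinite on some nonempty open set then it is infinite on every nonempty open set. -/
theorem statement12 (A : ℕ → Type) [∀ i, Fintype (A i)] [∀ i, Nonempty (A i)]
    (M : ∀ i, Matrix (A i) (A (i + 1)) ℝ)
    (E : ℕ → Type) [∀ i, Fintype (E i)]
    [∀ i, TopologicalSpace (E i)] [∀ i, DiscreteTopology (E i)]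
    [∀ i, MeasurableSpace (E i)] [∀ i, DiscreteMeasurableSpace (E i)]
    (src : ∀ i, E i → A i) (rng : ∀ i, E i → A (i + 1))
    (hM : ∀ i a b, M i a b = (Nat.card {e : E i // src i e = a ∧ rng i e = b} : ℝ))
    (hprim : Primitive M)
    (ν : MeasureTheory.Measure (EdgePathSpace E src rng))
    (hcentral : ∀ n (x y : ∀ i, E i), AllowedWord src rng x n → AllowedWord src rng y n →
      rng n (x n) = rng n (y n) →
      (thinCyl src rng x n).Nonempty → (thinCyl src rng y n).Nonempty →
      ν (thinCyl src rng x n) = ν (thinCyl src rng y n)) :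
    ((∃ U : Set (EdgePathSpace E src rng), IsOpen U ∧ U.Nonempty ∧ 0 < ν U ∧ ν U < ⊤) →
      ∀ U : Set (EdgePathSpace E src rng), IsOpen U → U.Nonempty → 0 < ν U ∧ ν U < ⊤) ∧
    ((∃ U : Set (EdgePathSpace E src rng), IsOpen U ∧ U.Nonempty ∧ ν U = ⊤) →
      ∀ U : Set (EdgePathSpace E src rng), IsOpen U → U.Nonempty → ν U = ⊤) := by
  have bound : ∀ U : Set (EdgePathSpace E src rng), IsOpen U → U.Nonempty →
      ∃ N : ℕ, ν Set.univ ≤ N * ν U := by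
    rintro U hU ⟨p, hp⟩
    obtain ⟨k, hk⟩ := exists_thinCyl_subset hU hp
    obtain ⟨n, hkn, hn⟩ := exists_splice_of_primitive (src := src) (rng := rng) hM hprim k
    obtain ⟨N, hN⟩ := measure_univ_le_of_thinCyl_le ν n
    refine ⟨N, hN _ fun q => ?_⟩
    obtain ⟨r, hrp, hrq⟩ := hn p q
    have hend : rng n (q.1 n) = rng n (r.1 n) := by
      rw [q.2 n, r.2 n, hrq (n + 1) n.lt_succ_self]
    rw [hcentral n q.1 r.1 (fun i _ => q.2 i) (fun i _ => r.2 i) hend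
      ⟨q, fun _ _ => rfl⟩ ⟨r, fun _ _ => rfl⟩]
    exact MeasureTheory.measure_mono fun s hs =>
      hk fun i hi => (hs i (hi.trans hkn)).trans (hrp i hi)
  constructor
  · rintro ⟨V, hV, hVne, hVpos, hVfin⟩ U hU hUne
    obtain ⟨N, hN⟩ := bound V hV hVne
    obtain ⟨N', hN'⟩ := bound U hU hUne
    constructor
    · refine pos_iff_ne_zero.2 fun h => hVpos.ne' ?_
      rw [h, mul_zero] at hN'
      exact le_antisymm ((MeasureTheory.measure_mono (Set.subset_univ V)).trans hN') zero_le
    · exact ((MeasureTheory.measure_mono (Set.subset_univ U)).trans hN).trans_lt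
        (ENNReal.mul_lt_top (ENNReal.natCast_lt_top N) hVfin)
  · rintro ⟨V, -, -, hV⟩ U hU hUne
    obtain ⟨N, hN⟩ := bound U hU hUne
    by_contra h
    have hfin := ((MeasureTheory.measure_mono (Set.subset_univ V)).trans hN).trans_lt
      (ENNReal.mul_lt_top (ENNReal.natCast_lt_top N) (lt_top_iff_ne_top.2 h))
    exact hfin.ne hV
end
end

section
/- Let A = (A_i) and B = (B_i) be sequences of nonnegative real matrices of the same sizes (both indexed by A_i × A_{i+1}) with B_i ≤ A_i entrywise for all i, set C_i = A_i − B_i, and form the block sequence N_i = [[A_i, C_i],[0, B_i]] (indexed by (A_i' ⊔ A_i) × (A_{i+1}' ⊔ A_{i+1}), where A_i' is a disjoint copy of A_i carrying the A-block). Define the matrices Ĉ_i^n by N_i^n = [[A_i^n, Ĉ_i^n],[0, B_i^n]]. Then: (i) Ĉ_i^n = A_i^n − B_i^n for all i ≤ n; and (ii) for every w ∈ V_B, the limits lim_{n→∞} N_i^n e(w_{n+1}) exist for all i (where e is the zero-extension of a vector into the B-block coordinates) if and only if the limits lim_{n→∞} A_i^n w_{n+1} exist for all i; that is, w is N/B-distinguished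 iff it is A/B-distinguished. -/
open Filter Topology Matrix

noncomputable section

/-- Given matrix sequences `A, B` of the same sizes with `B ≤ A` entrywise, the block
sequence `N_i = [[A_i, A_i - B_i],[0, B_i]]` on the doubled alphabet `α_i ⊕ α_i`
(left summand = the primed copy `A_i'` carrying the `A` block). -/
def coverMat {α : ℕ → Type} (A B : ∀ i, Matrix (α i) (α (i + 1)) ℝ) :
    ∀ i, Matrix (α i ⊕ α i) (α (i + 1) ⊕ α (i + 1)) ℝ :=
  fun i => Matrix.of fun x y =>
    match x, y with
    | Sum.inl a, Sum.inl b => A i a b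
    | Sum.inl a, Sum.inr b => A i a b - B i a b
    | Sum.inr _, Sum.inl _ => 0
    | Sum.inr a, Sum.inr b => B i a b

theorem coverMat_eq_fromBlocks {α : ℕ → Type} (A B : ∀ i, Matrix (α i) (α (i + 1)) ℝ) (i : ℕ) :
    coverMat A B i = fromBlocks (A i) (A i - B i) 0 (B i) := by
  ext (a | a) (b | b) <;> rfl

theorem matProd_coverMat {α : ℕ → Type} [∀ i, Fintype (α i)]
    (A B : ∀ i, Matrix (α i) (α (i + 1)) ℝ) (i m : ℕ) :
    matProd (A := fun j => α j ⊕ α j) (coverMat A B) i m =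
      fromBlocks (matProd A i m) (matProd A i m - matProd B i m) 0 (matProd B i m) := by
  induction m with
  | zero => exact coverMat_eq_fromBlocks A B i
  | succ m ih =>
    simp only [matProd]
    rw [ih, coverMat_eq_fromBlocks, fromBlocks_multiply]
    simp [Matrix.mul_sub, Matrix.sub_mul]

theorem matProd_mulVec_of_mem_V0 {α : ℕ → Type} [∀ i, Fintype (α i)]
    {B : ∀ i, Matrix (α i) (α (i + 1)) ℝ} {w : ∀ i, α i → ℝ} (hw : w ∈ V0 B) (i m : ℕ) :
    (matProd B i m).mulVec (w (i + m + 1)) = w i := by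
  induction m with
  | zero => exact (hw.2 i).symm
  | succ m ih =>
    rw [matProd, ← Matrix.mulVec_mulVec]
    exact (congrArg (matProd B i m).mulVec (hw.2 (i + m + 1)).symm).trans ih

theorem matProd_coverMat_mulVec {α : ℕ → Type} [∀ i, Fintype (α i)]
    (A : ∀ i, Matrix (α i) (α (i + 1)) ℝ) {B : ∀ i, Matrix (α i) (α (i + 1)) ℝ}
    {w : ∀ i, α i → ℝ} (hw : w ∈ V0 B) (i m : ℕ) :
    (matProd (A := fun j => α j ⊕ α j) (coverMat A B) i m).mulVec
        (Sum.elim (0 : α (i + m + 1) → ℝ) (w (i + m + 1))) =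
      Sum.elim ((matProd A i m).mulVec (w (i + m + 1)) - w i) (w i) := by
  rw [matProd_coverMat, fromBlocks_mulVec]
  simp [Matrix.sub_mulVec, matProd_mulVec_of_mem_V0 hw]

/-- with `B ≤ A` entrywise, `C = A - B` and `N = [[A, C],[0, B]]`, and the
upper-right blocks `Ĉ_i^n` of the products `N_i^n`:
(i) `Ĉ_i^n = A_i^n − B_i^n`; and (ii) for every `w ∈ V_B`, all the limits
`lim_n N_i^n e(w_{n+1})` exist (where `e` is the zero-extension into the `B`-block
coordinates) iff all the limits `lim_n A_i^n w_{n+1}` exist; that is, `w` is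
`N/B`-distinguished iff it is `A/B`-distinguished. -/
theorem statement17 (α : ℕ → Type) [∀ i, Fintype (α i)] [∀ i, Nonempty (α i)]
    (A B : ∀ i, Matrix (α i) (α (i + 1)) ℝ)
    (hB0 : ∀ i a b, 0 ≤ B i a b)
    (hBA : ∀ i a b, B i a b ≤ A i a b) :
    (∀ i m (a b : _), matProd (A := fun j => α j ⊕ α j) (coverMat A B) i m (Sum.inl a) (Sum.inr b)
        = matProd A i m a b - matProd B i m a b) ∧
    (∀ w, w ∈ Vpos B →
      ((∀ i, ∃ u : (α i ⊕ α i) → ℝ,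
          Tendsto (fun m => (matProd (A := fun j => α j ⊕ α j) (coverMat A B) i m).mulVec
            (Sum.elim (0 : α (i + m + 1) → ℝ) (w (i + m + 1)))) atTop (𝓝 u)) ↔
        (∀ i, ∃ u : α i → ℝ,
          Tendsto (fun m => (matProd A i m).mulVec (w (i + m + 1))) atTop (𝓝 u)))) := by
  refine ⟨fun i m a b => by rw [matProd_coverMat]; rfl, fun w hw => forall_congr' fun i => ?_⟩
  simp only [matProd_coverMat_mulVec A hw.1 i]
  constructor
  · rintro ⟨u, hu⟩
    refine ⟨fun a => u (Sum.inl a) + w i a, tendsto_pi_nhds.2 fun a => ?_⟩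
    simpa using (tendsto_pi_nhds.1 hu (Sum.inl a)).add_const (w i a)
  · rintro ⟨u, hu⟩
    refine ⟨Sum.elim (u - w i) (w i), tendsto_pi_nhds.2 ?_⟩
    rintro (a | a)
    · exact (tendsto_pi_nhds.1 hu a).sub_const (w i a)
    · exact tendsto_const_nhds
end
end
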